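/- Let n ≥ 2 and let V : ℝⁿ → ℝⁿ (Euclidean space with its standard inner product and Lebesgue measure) be continuously differentiable. Define the divergence div V : ℝⁿ → ℝ by div V(x) = Σ_{i=1}^{n} ⟪(DV(x))(eᵢ), eᵢ⟫, where DV(x) is the Fréchet derivative of V at x and e₁,…,eₙ is the standard orthonormal basis. Let p be the real number with 1/p + 1/n = 1, and assume V ∈ L^p(ℝⁿ), i.e. ∫_{ℝⁿ} ‖V(x)‖^p dx < ∞. Assume moreover that div V(x) ≥ 0 for all x outside some compact subset of ℝⁿ. Then div V is Lebesgue-integrable on ℝⁿ and ∫_{ℝⁿ} div V(x) dx = 0. -/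

import Mathlib

open Metric MeasureTheory Filter
open scoped RealInnerProductSpace

/-- Integration by parts for the divergence, tested against a compactly supported function. -/
lemma integral_mul_divergence_eq_neg {n : ℕ}
    {V : EuclideanSpace ℝ (Fin n) → EuclideanSpace ℝ (Fin n)} (hV : ContDiff ℝ 1 V)
    {φ : EuclideanSpace ℝ (Fin n) → ℝ} (hφ : ContDiff ℝ 1 φ) (hφc : HasCompactSupport φ) :
    ∫ x, φ x * ∑ i : Fin n, ⟪fderiv ℝ V x (EuclideanSpace.single i (1 : ℝ)),
        EuclideanSpace.single i (1 : ℝ)⟫ = -∫ x, fderiv ℝ φ x (V x) := by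
  have hdV (i : Fin n) (x : EuclideanSpace ℝ (Fin n)) :
      ⟪fderiv ℝ V x (EuclideanSpace.single i (1 : ℝ)), EuclideanSpace.single i (1 : ℝ)⟫ =
        fderiv ℝ (fun y => V y i) x (EuclideanSpace.single i (1 : ℝ)) := by
    have h := ((EuclideanSpace.proj (𝕜 := ℝ) i).hasFDerivAt.comp x
      (hV.differentiable one_ne_zero x).hasFDerivAt).fderiv
    have h' : fderiv ℝ (fun y => V y i) x = (EuclideanSpace.proj (𝕜 := ℝ) i).comp (fderiv ℝ V x) :=
      h
    rw [h', EuclideanSpace.inner_single_right]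
    simp
  have hVi (i : Fin n) : ContDiff ℝ 1 (fun y => V y i) :=
    (EuclideanSpace.proj (𝕜 := ℝ) i).contDiff.comp hV
  have hφV (x : EuclideanSpace ℝ (Fin n)) : fderiv ℝ φ x (V x) =
      ∑ i : Fin n, fderiv ℝ φ x (EuclideanSpace.single i (1 : ℝ)) * V x i := by
    conv_lhs => rw [← (EuclideanSpace.basisFun (Fin n) ℝ).sum_repr (V x)]
    simp [mul_comm]
  have hd {f : EuclideanSpace ℝ (Fin n) → ℝ} (hf : ContDiff ℝ 1 f) (v) :
      Continuous fun x => fderiv ℝ f x v :=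
    (hf.continuous_fderiv one_ne_zero).clm_apply continuous_const
  have hleft (i : Fin n) : Integrable fun x =>
      φ x * fderiv ℝ (fun y => V y i) x (EuclideanSpace.single i (1 : ℝ)) :=
    (hφ.continuous.mul (hd (hVi i) _)).integrable_of_hasCompactSupport hφc.mul_right
  have hright (i : Fin n) : Integrable fun x =>
      fderiv ℝ φ x (EuclideanSpace.single i (1 : ℝ)) * V x i :=
    ((hd hφ _).mul (hVi i).continuous).integrable_of_hasCompactSupport
      (hφc.fderiv_apply ℝ _).mul_right
  simp_rw [hdV, hφV, Finset.mul_sum]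
  rw [integral_finsetSum _ fun i _ => hleft i, integral_finsetSum _ fun i _ => hright i,
    ← Finset.sum_neg_distrib]
  refine Finset.sum_congr rfl fun i _ => ?_
  exact integral_mul_fderiv_eq_neg_fderiv_mul_of_integrable (hright i) (hleft i)
    ((hφ.continuous.mul (hVi i).continuous).integrable_of_hasCompactSupport hφc.mul_right)
    (fun x _ => hφ.differentiable one_ne_zero x)
    (fun x _ => (hVi i).differentiable one_ne_zero x)

section

variable {E : Type*} [NormedAddCommGroup E] [NormedSpace ℝ E] [MeasurableSpace E] [BorelSpace E]
  [FiniteDimensional ℝ E] {μ : Measure E}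

/-- The `L^d` norm of the derivative is invariant under dilations in dimension `d`. -/
lemma integral_norm_fderiv_comp_inv_smul_rpow_finrank [μ.IsAddHaarMeasure] (φ : E → ℝ) {r : ℝ}
    (hr : 0 < r) :
    ∫ x, ‖fderiv ℝ (fun y => φ (r⁻¹ • y)) x‖ ^ (Module.finrank ℝ E : ℝ) ∂μ =
      ∫ x, ‖fderiv ℝ φ x‖ ^ (Module.finrank ℝ E : ℝ) ∂μ := by
  simp_rw [fderiv_comp_smul, norm_smul, Real.norm_of_nonneg (inv_pos.2 hr).le, Real.rpow_natCast,
    mul_pow]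
  rw [integral_const_mul,
    Measure.integral_comp_inv_smul μ (fun x => ‖fderiv ℝ φ x‖ ^ Module.finrank ℝ E) r,
    abs_of_pos (by positivity), smul_eq_mul, ← mul_assoc, ← mul_pow, inv_mul_cancel₀ hr.ne', one_pow,
    one_mul]

/-- If `V ∈ L^p` with `p` conjugate to the dimension, then the derivatives of the dilated cutoffs
`φ (x / r)` paired with `V` have vanishing total integral in the limit `r → ∞`. -/
lemma tendsto_integral_fderiv_comp_inv_smul_apply [μ.IsAddHaarMeasure] {p : ℝ}
    (hp : p.HolderConjugate (Module.finrank ℝ E)) {V : E → E} (hV : MemLp V (ENNReal.ofReal p) μ)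
    {φ : E → ℝ} (hφ : ContDiff ℝ 1 φ) (hφc : HasCompactSupport φ)
    (hφ1 : ∀ x ∈ ball (0 : E) 1, φ x = 1) :
    Tendsto (fun k : ℕ => ∫ x, fderiv ℝ (fun y => φ ((k + 1 : ℝ)⁻¹ • y)) x (V x) ∂μ) atTop
      (nhds 0) := by
  set d : ℝ := (Module.finrank ℝ E : ℝ)
  set s : ℕ → Set E := fun k => (ball 0 (k + 1 : ℝ))ᶜ
  have hs (k : ℕ) : MeasurableSet (s k) := measurableSet_ball.compl
  have hp0 := hp.pos
  have hVp : Integrable (fun x => ‖V x‖ ^ p) μ := by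
    simpa [ENNReal.toReal_ofReal hp0.le] using
      hV.integrable_norm_rpow (by simpa using hp0) ENNReal.ofReal_ne_top
  have htail : Tendsto (fun k => ∫ x in s k, ‖V x‖ ^ p ∂μ) atTop (nhds 0) := by
    have hanti : Antitone s := fun j k hjk =>
      Set.compl_subset_compl.2 (ball_subset_ball (by gcongr))
    have hinter : ⋂ k, s k = ∅ := by
      refine Set.eq_empty_of_forall_notMem fun x hx => ?_
      obtain ⟨k, hk⟩ := exists_nat_gt ‖x‖
      refine Set.mem_iInter.1 hx k ?_
      rw [mem_ball_zero_iff]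
      linarith
    simpa [hinter] using hanti.tendsto_setIntegral hs hVp.integrableOn
  have hbound (k : ℕ) : ‖∫ x, fderiv ℝ (fun y => φ ((k + 1 : ℝ)⁻¹ • y)) x (V x) ∂μ‖ ≤
      (∫ x in s k, ‖V x‖ ^ p ∂μ) ^ (1 / p) * (∫ x, ‖fderiv ℝ φ x‖ ^ d ∂μ) ^ (1 / d) := by
    have hk : (0 : ℝ) < k + 1 := by positivity
    set ψ : E → ℝ := fun y => φ ((k + 1 : ℝ)⁻¹ • y)
    have hψ : ContDiff ℝ 1 ψ := hφ.comp (contDiff_const_smul _)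
    have hψc : HasCompactSupport ψ := hφc.comp_smul (inv_ne_zero hk.ne')
    have hψ0 (x : E) (hx : x ∈ ball 0 (k + 1 : ℝ)) : fderiv ℝ ψ x = 0 := by
      have : ψ =ᶠ[nhds x] fun _ => 1 := by
        filter_upwards [isOpen_ball.mem_nhds hx] with y hy
        refine hφ1 _ ?_
        rw [mem_ball_zero_iff] at hy ⊢
        rw [norm_smul, Real.norm_of_nonneg (inv_pos.2 hk).le, inv_mul_lt_one₀ hk]
        exact hy
      rw [this.fderiv_eq, fderiv_fun_const, Pi.zero_apply]
    have hψLd : MemLp (fun x => ‖fderiv ℝ ψ x‖) (ENNReal.ofReal d) μ :=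
      (hψ.continuous_fderiv one_ne_zero).norm.memLp_of_hasCompactSupport (hψc.fderiv ℝ).norm
    have hVLp : MemLp (fun x => ‖(s k).indicator V x‖) (ENNReal.ofReal p) μ :=
      (hV.indicator (hs k)).norm
    calc ‖∫ x, fderiv ℝ ψ x (V x) ∂μ‖
        ≤ ∫ x, ‖(s k).indicator V x‖ * ‖fderiv ℝ ψ x‖ ∂μ := by
          have : ENNReal.HolderConjugate (ENNReal.ofReal p) (ENNReal.ofReal d) :=
            hp.ennrealOfReal
          refine norm_integral_le_of_norm_le (hVLp.integrable_mul hψLd) (.of_forall fun x => ?_)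
          by_cases hx : x ∈ s k
          · rw [Set.indicator_of_mem hx, mul_comm]
            exact (fderiv ℝ ψ x).le_opNorm _
          · simp [hψ0 x (not_not.1 hx)]
      _ ≤ (∫ x, ‖(s k).indicator V x‖ ^ p ∂μ) ^ (1 / p) *
            (∫ x, ‖fderiv ℝ ψ x‖ ^ d ∂μ) ^ (1 / d) :=
          integral_mul_le_Lp_mul_Lq_of_nonneg hp (.of_forall fun _ => norm_nonneg _)
            (.of_forall fun _ => norm_nonneg _) hVLp hψLd
      _ = _ := by
          rw [integral_norm_fderiv_comp_inv_smul_rpow_finrank φ hk, ← integral_indicator (hs k)]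
          congr 3
          ext x
          by_cases hx : x ∈ s k <;> simp [hx, Real.zero_rpow hp0.ne']
  refine squeeze_zero_norm hbound ?_
  simpa [Real.zero_rpow (inv_ne_zero hp0.ne')] using
    (htail.rpow_const (p := 1 / p) (.inr (by positivity))).mul_const
      ((∫ x, ‖fderiv ℝ φ x‖ ^ d ∂μ) ^ (1 / d))

/-- A continuous function that is nonnegative outside a compact set is integrable as soon as its
integrals against the dilated cutoffs `φ (x / r)` converge, and the limit is its integral. -/
lemma integrable_and_integral_eq_of_tendsto_integral_comp_inv_smul_mul
    [IsFiniteMeasureOnCompacts μ] {f : E → ℝ} (hf : Continuous f) {K : Set E} (hK : IsCompact K)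
    (hfK : ∀ x ∉ K, 0 ≤ f x) {φ : E → ℝ} (hφ : Continuous φ) (hφc : HasCompactSupport φ)
    (hφ0 : ∀ x, 0 ≤ φ x) (hφle : ∀ x, φ x ≤ 1) (hφ1 : ∀ x ∈ ball (0 : E) 1, φ x = 1) {L : ℝ}
    (hL : Tendsto (fun k : ℕ => ∫ x, φ ((k + 1 : ℝ)⁻¹ • x) * f x ∂μ) atTop (nhds L)) :
    Integrable f μ ∧ ∫ x, f x ∂μ = L := by
  set ψ : ℕ → E → ℝ := fun k x => φ ((k + 1 : ℝ)⁻¹ • x)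
  have hψ (k : ℕ) : Continuous (ψ k) := hφ.comp (continuous_const_smul _)
  have hψc (k : ℕ) : HasCompactSupport (ψ k) := hφc.comp_smul (by positivity)
  have hψ1 (k : ℕ) (x : E) (hx : x ∈ ball (0 : E) (k + 1)) : ψ k x = 1 := by
    have hk : (0 : ℝ) < k + 1 := by positivity
    refine hφ1 _ ?_
    rw [mem_ball_zero_iff] at hx ⊢
    rw [norm_smul, Real.norm_of_nonneg (inv_pos.2 hk).le, inv_mul_lt_one₀ hk]
    exact hx
  have hψint {g : E → ℝ} (hg : Continuous g) (k : ℕ) : Integrable (fun x => ψ k x * g x) μ :=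
    ((hψ k).mul hg).integrable_of_hasCompactSupport (hψc k).mul_right
  set g : E → ℝ := fun x => |f x| - f x
  have hg : Continuous g := hf.abs.sub hf
  have hg0 (x : E) : 0 ≤ g x := sub_nonneg.2 (le_abs_self _)
  have hgint : Integrable g μ := hg.integrable_of_hasCompactSupport
    (.intro hK fun x hx => sub_eq_zero.2 (abs_of_nonneg (hfK x hx)))
  have hcover : AECover μ atTop fun k : ℕ => ball (0 : E) (k + 1 : ℝ) :=
    aecover_ball (tendsto_natCast_atTop_atTop.atTop_add tendsto_const_nhds)
  have hfint : Integrable f μ := by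
    refine hcover.integrable_of_integral_norm_bounded (L + 1 + ∫ x, g x ∂μ)
      (fun k => (hf.continuousOn.integrableOn_compact (isCompact_closedBall 0 _)).mono_set
        ball_subset_closedBall) ?_
    filter_upwards [hL.eventually_le_const (lt_add_one L)] with k hk
    calc ∫ x in ball (0 : E) (k + 1), ‖f x‖ ∂μ
        = ∫ x in ball (0 : E) (k + 1), ψ k x * |f x| ∂μ :=
          setIntegral_congr_fun measurableSet_ball fun x hx => by
            simp [hψ1 k x hx]
      _ ≤ ∫ x, ψ k x * |f x| ∂μ :=
          setIntegral_le_integral (hψint hf.abs k)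
            (.of_forall fun x => mul_nonneg (hφ0 _) (abs_nonneg _))
      _ = ∫ x, ψ k x * f x ∂μ + ∫ x, ψ k x * g x ∂μ := by
          rw [← integral_add (hψint hf k) (hψint hg k)]
          exact integral_congr_ae (.of_forall fun x => by simp only [g]; ring)
      _ ≤ L + 1 + ∫ x, g x ∂μ :=
          add_le_add hk (integral_mono (hψint hg k) hgint fun x =>
            mul_le_of_le_one_left (hg0 x) (hφle _))
  refine ⟨hfint, tendsto_nhds_unique ?_ hL⟩
  refine tendsto_integral_filter_of_dominated_convergence (fun x => |f x|)
    (.of_forall fun k => (hψint hf k).aestronglyMeasurable)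
    (.of_forall fun k => .of_forall fun x => ?_) hfint.abs (.of_forall fun x => ?_)
  · rw [norm_mul, Real.norm_of_nonneg (hφ0 _)]
    exact mul_le_of_le_one_left (abs_nonneg _) (hφle _)
  · obtain ⟨N, hN⟩ := exists_nat_gt ‖x‖
    refine tendsto_const_nhds.congr' ?_
    filter_upwards [eventually_ge_atTop N] with k hk
    have hNk : (N : ℝ) ≤ k := by exact_mod_cast hk
    have h1 : ψ k x = 1 := hψ1 k x (by rw [mem_ball_zero_iff]; linarith)
    change f x = ψ k x * f x
    rw [h1, one_mul]

end

/-- Euclidean-space instance of case (1) of Corollary 5.2: if `V` is a `C¹` vector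
field on `ℝⁿ` (`n ≥ 2`) with `V ∈ L^p` where `1/p + 1/n = 1`, and `div V ≥ 0`
outside a compact set, then `div V` is integrable with total integral `0`. -/
theorem divergence_theorem_Lp_vanishing
    (n : ℕ) (hn : 2 ≤ n)
    (V : EuclideanSpace ℝ (Fin n) → EuclideanSpace ℝ (Fin n))
    (hV : ContDiff ℝ 1 V)
    (divV : EuclideanSpace ℝ (Fin n) → ℝ)
    (hdiv : ∀ x, divV x =
      ∑ i : Fin n, ⟪fderiv ℝ V x (EuclideanSpace.single i (1 : ℝ)),
        EuclideanSpace.single i (1 : ℝ)⟫)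
    (p : ℝ) (hp : 1 / p + 1 / (n : ℝ) = 1)
    (hLp : Integrable (fun x => ‖V x‖ ^ p))
    (hpos : ∃ K : Set (EuclideanSpace ℝ (Fin n)), IsCompact K ∧ ∀ x ∉ K, 0 ≤ divV x) :
    Integrable divV ∧ ∫ x, divV x = 0 := by
  obtain ⟨K, hK, hfK⟩ := hpos
  have hn' : (2 : ℝ) ≤ n := by exact_mod_cast hn
  have hp1 : 1 < p := by
    have hinv : 1 / (n : ℝ) ≤ 1 / 2 := one_div_le_one_div_of_le two_pos hn'
    have hninv : 0 < 1 / (n : ℝ) := by positivity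
    have hp0 : 0 < p := one_div_pos.1 (by linarith)
    exact (div_lt_one hp0).1 (by linarith)
  have hconj : p.HolderConjugate (Module.finrank ℝ (EuclideanSpace ℝ (Fin n))) := by
    rw [finrank_euclideanSpace_fin, Real.holderConjugate_iff]
    exact ⟨hp1, by simpa using hp⟩
  have hVLp : MemLp V (ENNReal.ofReal p) := by
    refine (integrable_norm_rpow_iff hV.continuous.aestronglyMeasurable
      (by simpa using zero_lt_one.trans hp1) ENNReal.ofReal_ne_top).1 ?_
    rwa [ENNReal.toReal_ofReal (zero_lt_one.trans hp1).le]
  obtain rfl : divV = _ := funext hdiv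
  have hcont : Continuous fun x => ∑ i : Fin n,
      ⟪fderiv ℝ V x (EuclideanSpace.single i (1 : ℝ)), EuclideanSpace.single i (1 : ℝ)⟫ :=
    continuous_finsetSum _ fun i _ =>
      ((hV.continuous_fderiv one_ne_zero).clm_apply continuous_const).inner continuous_const
  let φ : ContDiffBump (0 : EuclideanSpace ℝ (Fin n)) := ⟨1, 2, one_pos, one_lt_two⟩
  have hφ1 (x) (hx : x ∈ ball (0 : EuclideanSpace ℝ (Fin n)) 1) : φ x = 1 :=
    φ.one_of_mem_closedBall (ball_subset_closedBall hx)
  have hlim := (tendsto_integral_fderiv_comp_inv_smul_apply hconj hVLp φ.contDiff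
    φ.hasCompactSupport hφ1).neg
  rw [neg_zero] at hlim
  refine integrable_and_integral_eq_of_tendsto_integral_comp_inv_smul_mul hcont hK hfK
    φ.continuous φ.hasCompactSupport (fun _ => φ.nonneg) (fun _ => φ.le_one) hφ1
    (hlim.congr fun k => ?_)
  have hk : ((k : ℝ) + 1)⁻¹ ≠ 0 := by positivity
  exact (integral_mul_divergence_eq_neg hV (φ := fun x => φ (((k : ℝ) + 1)⁻¹ • x))
    (φ.contDiff.comp (contDiff_const_smul _)) (φ.hasCompactSupport.comp_smul hk)).symm
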